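/- Let p be an odd prime and let G be a non-Abelian finite p-group such that every non-linear irreducible complex character of G has kernel of order exactly p^m for a fixed integer m ≥ 1. Then the nilpotency class of G is 2, i.e., G' ⊆ Z(G). -/

import Mathlib

open CategoryTheory

/-- The kernel of the character of a complex representation `V` of `G`:
`ker χ = {g ∈ G : χ(g) = χ(1)}`. -/
noncomputable def charKer {G : Type} [Group G] (V : FDRep ℂ G) : Set G :=
  {g | V.character g = V.character 1}

/-- The center of the character of a complex representation `V` of `G`:
`Z(χ) = {g ∈ G : |χ(g)| = χ(1)}`. -/
noncomputable def charCenter {G : Type} [Group G] (V : FDRep ℂ G) : Set G :=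
  {g | (‖V.character g‖ : ℂ) = V.character 1}

open Polynomial in
/-- A complex endomorphism of finite order whose trace is the dimension is the identity. -/
theorem Module.End.eq_one_of_pow_eq_one_of_trace_eq_finrank {V : Type*} [AddCommGroup V]
    [Module ℂ V] [FiniteDimensional ℂ V] (f : Module.End ℂ V) {n : ℕ} (hn : n ≠ 0)
    (hf : f ^ n = 1) (htr : LinearMap.trace ℂ V f = Module.finrank ℂ V) : f = 1 := by
  have hdvd : minpoly ℂ f ∣ X ^ n - 1 := minpoly.dvd _ _ (by simp [hf])
  have hnorm : ∀ μ ∈ f.charpoly.roots, ‖μ‖ = 1 := by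
    intro μ hμ
    have h1 : f.HasEigenvalue μ :=
      (hasEigenvalue_iff_isRoot_charpoly f μ).2 (isRoot_of_mem_roots hμ)
    have h2 : (X ^ n - 1 : ℂ[X]).IsRoot μ := (isRoot_of_hasEigenvalue h1).dvd hdvd
    have h3 : μ ^ n = 1 := by simpa [sub_eq_zero] using h2
    exact Complex.norm_eq_one_of_pow_eq_one h3 hn
  have hsplit : f.charpoly.Splits := IsAlgClosed.splits _
  have hcard : Multiset.card f.charpoly.roots = Module.finrank ℂ V := by
    rw [← hsplit.natDegree_eq_card_roots, f.charpoly_natDegree]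
  have hone : ∀ μ ∈ f.charpoly.roots, μ = 1 := by
    have hsum : (f.charpoly.roots.map fun μ : ℂ => 1 - μ.re).sum = 0 := by
      rw [Multiset.sum_map_sub]
      have h := congrArg Complex.re (trace_eq_sum_roots_charpoly_of_splits hsplit)
      have h' : (f.charpoly.roots.sum).re = (f.charpoly.roots.map Complex.re).sum :=
        map_multiset_sum Complex.reAddGroupHom _
      rw [htr, h'] at h
      simp [hcard, ← h]
    intro μ hμ
    have hnn : ∀ x ∈ f.charpoly.roots.map fun μ : ℂ => 1 - μ.re, 0 ≤ x := by
      intro x hx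
      obtain ⟨ν, hν, rfl⟩ := Multiset.mem_map.1 hx
      linarith [Complex.re_le_norm ν, hnorm ν hν]
    have hre : 1 - μ.re = 0 :=
      Multiset.all_zero_of_le_zero_le_of_sum_eq_zero hnn hsum _ (Multiset.mem_map_of_mem _ hμ)
    have hre' : μ.re = 1 := by linarith
    have h4 := Complex.sq_norm μ
    rw [hnorm μ hμ, Complex.normSq_apply, hre'] at h4
    apply Complex.ext
    · simpa using hre'
    · simpa using (by nlinarith : μ.im * μ.im = 0)
  have hchar : f.charpoly = (X - C 1) ^ Module.finrank ℂ V := by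
    rw [hsplit.eq_prod_roots_of_monic f.charpoly_monic,
      Multiset.eq_replicate.2 ⟨hcard, hone⟩]
    simp
  have hsq : Squarefree (minpoly ℂ f) := by
    refine Squarefree.squarefree_of_dvd hdvd (Separable.squarefree ?_)
    simpa using separable_X_pow_sub_C (1 : ℂ) (by exact_mod_cast hn) one_ne_zero
  have hd : minpoly ℂ f ∣ X - C 1 := by
    have : minpoly ℂ f ∣ (X - C 1) ^ Module.finrank ℂ V := hchar ▸ f.minpoly_dvd_charpoly
    exact (hsq.isRadical) _ _ this
  have h5 := (minpoly.dvd_iff).1 hd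
  simpa [sub_eq_zero] using h5

/-- The kernel of the character of `V` is the kernel of the representation. -/
theorem mem_charKer_iff {G : Type} [Group G] [Finite G] (V : FDRep ℂ G) (g : G) :
    g ∈ charKer V ↔ V.ρ g = 1 := by
  constructor
  · intro h
    refine Module.End.eq_one_of_pow_eq_one_of_trace_eq_finrank (V.ρ g) (orderOf_pos g).ne' ?_ ?_
    · rw [← map_pow, pow_orderOf_eq_one, map_one]
    · rw [← FDRep.char_one]
      exact h
  · intro h
    simp only [charKer, Set.mem_ofPred_eq, FDRep.character, h, map_one]

/-- The object of `FDRep ℂ G` given by an irreducible representation is simple. -/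
theorem FDRep.simple_of_isIrreducible {G W : Type} [Group G] [Fintype G] [AddCommGroup W]
    [Module ℂ W] [FiniteDimensional ℂ W] (ρ : Representation ℂ G W) [ρ.IsIrreducible] :
    Simple (FDRep.of ρ) := by
  rw [FDRep.simple_iff_char_is_norm_one]
  have hne : (Nat.card G : ℂ) ≠ 0 := by exact_mod_cast Nat.card_pos.ne'
  let := invertibleOfNonzero hne
  have h := Representation.char_orthonormal ρ ρ
  rw [if_pos ⟨.refl _⟩, inv_mul_eq_one₀ hne] at h
  exact h.symm

/-- A minimal nonzero subrepresentation is irreducible. -/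
theorem IsAtom.isIrreducible_toRepresentation {k G W : Type*} [Group G] [Field k]
    [AddCommGroup W] [Module k W] {ρ : Representation k G W} {T : Subrepresentation ρ}
    (hT : IsAtom T) : T.toRepresentation.IsIrreducible := by
  have hne : ∃ x ∈ T, x ≠ 0 := by
    by_contra! h
    exact hT.1 (le_bot_iff.1 fun x hx => (Submodule.mem_bot k).2 (h x hx))
  refine { exists_pair_ne := ⟨⊥, ⊤, fun h => ?_⟩, eq_bot_or_eq_top := fun U => ?_ }
  · obtain ⟨x, hx, hx0⟩ := hne
    have hmem : (⟨x, hx⟩ : T.toSubmodule) ∈ (⊥ : Subrepresentation T.toRepresentation) :=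
      h ▸ Submodule.mem_top
    exact hx0 (congrArg Subtype.val ((Submodule.mem_bot k).1 hmem))
  · let U' : Subrepresentation ρ :=
      { toSubmodule := U.toSubmodule.map T.toSubmodule.subtype
        apply_mem_toSubmodule := by
          rintro g _ ⟨y, hy, rfl⟩
          exact ⟨_, U.apply_mem_toSubmodule g hy, rfl⟩ }
    have hle : U' ≤ T := by
      rintro _ ⟨y, -, rfl⟩
      exact y.2
    rcases hT.le_iff.1 hle with h | h
    · refine Or.inl (le_antisymm (fun y hy => ?_) bot_le)
      have hmem : (y : W) ∈ (⊥ : Subrepresentation ρ) := h.le ⟨y, hy, rfl⟩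
      exact (Submodule.mem_bot k).2 (Subtype.ext ((Submodule.mem_bot k).1 hmem))
    · right
      refine le_antisymm le_top fun y _ => ?_
      have hmem : (y : W) ∈ U' := h.ge y.2
      obtain ⟨z, hz, hzy⟩ := hmem
      rwa [← Subtype.ext hzy]

open scoped MonoidAlgebra in
/-- An element outside a normal subgroup `N` acts non-trivially in some irreducible representation
with kernel containing `N`. -/
theorem exists_simple_map_ne_one {G : Type} [Group G] [Fintype G] (N : Subgroup G) [N.Normal]
    {g : G} (hg : g ∉ N) :
    ∃ V : FDRep ℂ G, Simple V ∧ (∀ n ∈ N, V.ρ n = 1) ∧ V.ρ g ≠ 1 := by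
  let σ := Representation.ofMulAction ℂ G (G ⧸ N)
  have hσN : ∀ n ∈ N, σ n = 1 := by
    intro n hn
    ext x : 1
    induction x using QuotientGroup.induction_on with
    | H x =>
      ext1
      have : (n • (x : G ⧸ N)) = x := by
        rw [MulAction.Quotient.smul_coe, smul_eq_mul, eq_comm, QuotientGroup.eq, ← mul_assoc]
        exact ‹N.Normal›.conj_mem' n hn x
      simp [σ, this]
  have hσg : σ g ≠ 1 := by
    intro h
    have h1 := congrArg (fun f => f (MonoidAlgebra.single ((1 : G) : G ⧸ N) 1)) h
    simp only [σ, Representation.ofMulAction_single, Module.End.one_apply] at h1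
    have h2 := MonoidAlgebra.single_left_injective one_ne_zero h1
    rw [MulAction.Quotient.smul_coe, smul_eq_mul, mul_one, eq_comm, QuotientGroup.eq] at h2
    simp [hg] at h2
  by_contra! hall
  have hsimple : ∀ S : Submodule ℂ[G] σ.asModule, IsSimpleModule ℂ[G] S →
      ∀ x ∈ S, σ g (σ.asModuleEquiv x) = σ.asModuleEquiv x := by
    intro S hS x hx
    have hatom : IsAtom (Subrepresentation.ofSubmodule' S) :=
      (Subrepresentation.subrepresentationSubmoduleOrderIso.symm.isAtom_iff S).2
        (isSimpleModule_iff_isAtom.1 hS)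
    have := hatom.isIrreducible_toRepresentation
    have h := hall (FDRep.of (Subrepresentation.ofSubmodule' S).toRepresentation)
      (FDRep.simple_of_isIrreducible _) fun n hn => by
        ext y : 1
        exact Subtype.ext (LinearMap.congr_fun (hσN n hn) y.1)
    exact congrArg Subtype.val (LinearMap.congr_fun h ⟨x, hx⟩)
  apply hσg
  refine LinearMap.ext fun x => ?_
  have hx : σ.asModuleEquiv.symm x ∈
      sSup {S : Submodule ℂ[G] σ.asModule | IsSimpleModule ℂ[G] S} := by
    rw [IsSemisimpleModule.sSup_simples_eq_top]
    trivial
  rw [sSup_eq_iSup'] at hx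
  have := Submodule.iSup_induction _
    (motive := fun y => σ g (σ.asModuleEquiv y) = σ.asModuleEquiv y) hx
    (fun S y hy => hsimple S.1 S.2 y hy) (by simp) fun y z hy hz => by simp [hy, hz]
  simpa using this

/-- A representation of dimension at most one is trivial on the derived subgroup. -/
theorem commutator_le_ker_of_finrank_le_one {G V : Type*} [Group G] [AddCommGroup V] [Module ℂ V]
    [FiniteDimensional ℂ V] (ρ : Representation ℂ G V) (h : Module.finrank ℂ V ≤ 1) :
    commutator G ≤ ρ.ker := by
  have hs : ∀ f : Module.End ℂ V, ∃ c : ℂ, f = c • 1 := by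
    intro f
    rcases Nat.le_one_iff_eq_zero_or_eq_one.1 h with h | h
    · have := Module.finrank_zero_iff.1 h
      exact ⟨0, Subsingleton.elim _ _⟩
    · have h' : Module.finrank ℂ (Module.End ℂ V) = 1 := by
        rw [Module.finrank_linearMap, h]
      have := Module.finrank_pos_iff.1 (h ▸ one_pos : 0 < Module.finrank ℂ V)
      obtain ⟨c, hc⟩ := (finrank_eq_one_iff_of_nonzero' (1 : Module.End ℂ V) one_ne_zero).1 h' f
      exact ⟨c, hc.symm⟩
  rw [commutator_def, Subgroup.commutator_le]
  intro a _ b _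
  have hc : ρ a * ρ b = ρ b * ρ a := by
    obtain ⟨c, hc⟩ := hs (ρ a)
    simp [hc]
  rw [MonoidHom.mem_ker, commutatorElement_def]
  simp only [map_mul, hc]
  rw [mul_assoc (ρ b), ← map_mul ρ a, mul_inv_cancel, map_one, mul_one, ← map_mul,
    mul_inv_cancel, map_one]

/-- In a nilpotent group, a normal subgroup `K` with `G' ≤ K [G', G]` contains `G'`. -/
theorem le_of_le_sup_commutator {G : Type*} [Group G] [Group.IsNilpotent G] (K : Subgroup G)
    [K.Normal] (h : commutator G ≤ K ⊔ ⁅commutator G, ⊤⁆) : commutator G ≤ K := by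
  have hmap : ∀ A B : Subgroup G,
      A.map (QuotientGroup.mk' K) ≤ B.map (QuotientGroup.mk' K) ↔ A ≤ K ⊔ B := fun A B => by
    rw [Subgroup.map_le_map_iff, QuotientGroup.ker_mk', sup_comm]
  have hn : ∀ n, commutator G ≤ K ⊔ (⊤ : Subgroup G).lowerCentralSeries (n + 1) := by
    intro n
    induction n with
    | zero => rw [zero_add, Subgroup.top_lowerCentralSeries_one]; exact le_sup_right
    | succ n ih =>
      rw [← hmap] at h ih ⊢
      refine h.trans ?_
      rw [Subgroup.lowerCentralSeries_succ, Subgroup.map_commutator, Subgroup.map_commutator]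
      exact Subgroup.commutator_mono ih le_rfl
  obtain ⟨n, h0⟩ := Subgroup.nilpotent_iff_lowerCentralSeries.1 ‹Group.IsNilpotent G›
  have hle := (Subgroup.lowerCentralSeries_antitone (⊤ : Subgroup G) n.le_succ).trans h0.le
  exact (hn n).trans (sup_le le_rfl (hle.trans bot_le))

/-- If all non-linear irreducible characters of a nilpotent group have kernels of the same
order `p ^ m`, then `[G', G] = 1`. -/
theorem commutator_commutator_top_eq_bot_of_card_charKer {p m : ℕ} {G : Type} [Group G] [Fintype G]
    [Group.IsNilpotent G]
    (hker : ∀ V : FDRep ℂ G, Simple V → 1 < Module.finrank ℂ V →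
      Nat.card (charKer V) = p ^ m) :
    ⁅commutator G, (⊤ : Subgroup G)⁆ = ⊥ := by
  have hcard : ∀ (V : FDRep ℂ G), Simple V → ∀ g ∈ commutator G, V.ρ g ≠ 1 →
      Nat.card V.ρ.ker = p ^ m := by
    intro V hV g hg hne
    rw [← hker V hV]
    · exact Nat.card_congr (Equiv.setCongr (Set.ext fun x => (mem_charKer_iff V x).symm))
    · by_contra! h
      exact hne (commutator_le_ker_of_finrank_le_one V.ρ h hg)
  rw [eq_bot_iff]
  intro g hg
  by_contra hg1
  have hgG : g ∈ commutator G := Subgroup.commutator_le_left _ _ hg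
  obtain ⟨V, hV, -, hVg⟩ := exists_simple_map_ne_one ⊥ hg1
  have hlt : V.ρ.ker < V.ρ.ker ⊔ ⁅commutator G, ⊤⁆ :=
    left_lt_sup.2 fun h => hVg (h hg)
  refine hVg (le_of_le_sup_commutator V.ρ.ker ?_ hgG)
  intro x hx
  by_contra hxM
  obtain ⟨W, hW, hWM, hWx⟩ := exists_simple_map_ne_one _ hxM
  have hle : V.ρ.ker ⊔ ⁅commutator G, ⊤⁆ ≤ W.ρ.ker := hWM
  have hcV := hcard V hV g hgG hVg
  have hcW := hcard W hW x hx hWx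
  have heq := Subgroup.eq_of_le_of_card_ge (hlt.le.trans hle) (hcW.trans hcV.symm).le
  exact (hlt.trans_le hle).ne heq

/-- If every non-linear irreducible complex character of the non-Abelian finite `p`-group
`G` (`p` odd) has kernel of order exactly `p ^ m` for a fixed `m ≥ 1`, then `G` has
nilpotency class `2`, i.e. `G' ⊆ Z(G)`. -/
theorem nilpotencyClass_eq_two_of_kernels (p m : ℕ) (hp : p.Prime) (hodd : Odd p)
    (hm : 1 ≤ m) (G : Type) [Group G] [Fintype G] (hpG : IsPGroup p G)
    (hnab : ¬ ∀ a b : G, a * b = b * a)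
    (hker : ∀ V : FDRep ℂ G, Simple V → 1 < Module.finrank ℂ V →
      Nat.card (charKer V) = p ^ m) :
    (letI : Fact p.Prime := ⟨hp⟩; letI := hpG.isNilpotent;
      Group.nilpotencyClass G = 2) ∧ commutator G ≤ Subgroup.center G := by
  have : Fact p.Prime := ⟨hp⟩
  have hnil := hpG.isNilpotent
  have hbot := commutator_commutator_top_eq_bot_of_card_charKer hker
  constructor
  · apply le_antisymm
    · rw [← Subgroup.lowerCentralSeries_eq_bot_iff_nilpotencyClass_le,
        Subgroup.lowerCentralSeries_succ, Subgroup.top_lowerCentralSeries_one, hbot]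
    · by_contra! hlt
      have h1 := Subgroup.lowerCentralSeries_eq_bot_iff_nilpotencyClass_le.2
        (Nat.le_of_lt_succ hlt)
      rw [Subgroup.top_lowerCentralSeries_one] at h1
      refine hnab fun a b => ?_
      have h2 :=
        Subgroup.commutator_mem_commutator (Subgroup.mem_top a) (Subgroup.mem_top b)
      rw [← commutator_def, h1, Subgroup.mem_bot] at h2
      exact commutatorElement_eq_one_iff_mul_comm.1 h2
  · have h := Subgroup.commutator_eq_bot_iff_le_centralizer.1 hbot
    rwa [Subgroup.coe_top, Subgroup.centralizer_univ] at h
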